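/- arXiv:1304.5830 — 2 statements merged into one kernel-verified Lean document; each statement's English description precedes it below -/
import Mathlib

section
/- Bailey's ${}_4\phi_3$ summation formula: Let $n \ge 0$ be an integer and let $q, b, c$ be nonzero complex numbers such that all factors occurring in denominators below are nonzero. Then $\sum_{k=0}^{n} \frac{(q^{-n};q)_k (b;q)_k (c;q)_k (-q^{1-n}/(bc);q)_k}{(q;q)_k (q^{1-n}/b;q)_k (q^{1-n}/c;q)_k (-bc;q)_k} q^k$ equals $\frac{(q;q^2)_m (b^2;q^2)_m (c^2;q^2)_m (bc;q)_{2m}}{(b;q)_{2m} (c;q)_{2m} (b^2c^2;q^2)_m}$ if $n = 2m$ is even, and equals $0$ if $n = 2m+1$ is odd. -/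
set_option autoImplicit false

/-- The q-shifted factorial `(a;q)_n = ∏_{j=0}^{n-1} (1 - a q^j)`. -/
noncomputable def qPoch (q a : ℂ) (n : ℕ) : ℂ := ∏ j ∈ Finset.range n, (1 - a * q ^ j)

lemma qPoch_zero (q a : ℂ) : qPoch q a 0 = 1 := by simp [qPoch]

lemma qPoch_succ (q a : ℂ) (n : ℕ) : qPoch q a (n + 1) = qPoch q a n * (1 - a * q ^ n) := by
  simp [qPoch, Finset.prod_range_succ]

lemma qPoch_ne_zero_of_le {q a : ℂ} {k n : ℕ} (hkn : k ≤ n) (h : qPoch q a n ≠ 0) :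
    qPoch q a k ≠ 0 := by
  simp only [qPoch, Finset.prod_ne_zero_iff, Finset.mem_range] at h ⊢
  exact fun j hj => h j (hj.trans_le hkn)

/-- Splitting `(q;q)_{2m}` into its odd and even parts. -/
lemma qPoch_self_two_mul (q : ℂ) (m : ℕ) :
    qPoch q q (2 * m) = qPoch (q ^ 2) q m * qPoch (q ^ 2) (q ^ 2) m := by
  induction m with
  | zero => simp [qPoch_zero]
  | succ m ih =>
    rw [show 2 * (m + 1) = 2 * m + 1 + 1 by ring]
    simp only [qPoch_succ, ih]
    ring

/-- The factor `∏_{j<k} (-q^{1-n+j})` produced by reversing a q-shifted factorial. -/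
noncomputable def qRevFactor (q : ℂ) (n k : ℕ) : ℂ :=
  ∏ j ∈ Finset.range k, -(q ^ (1 - (n : ℤ)) * q ^ j)

lemma qRevFactor_ne_zero {q : ℂ} (hq : q ≠ 0) (n k : ℕ) : qRevFactor q n k ≠ 0 := by
  rw [qRevFactor, Finset.prod_ne_zero_iff]
  exact fun j _ => neg_ne_zero.2 (mul_ne_zero (zpow_ne_zero _ hq) (pow_ne_zero _ hq))

lemma qPoch_reverse {q a : ℂ} (hq : q ≠ 0) (ha : a ≠ 0) {n k : ℕ} (hkn : k ≤ n) :
    qPoch q (q ^ (1 - (n : ℤ)) / a) k * a ^ k * qPoch q a (n - k)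
      = qRevFactor q n k * qPoch q a n := by
  induction k with
  | zero => simp [qPoch_zero, qRevFactor]
  | succ k ih =>
    obtain ⟨l, rfl⟩ := Nat.exists_eq_add_of_le hkn
    have ih := ih (by omega)
    rw [show k + 1 + l - k = l + 1 by omega, qPoch_succ q a l] at ih
    rw [show k + 1 + l - (k + 1) = l by omega, qPoch_succ, qRevFactor, Finset.prod_range_succ,
      ← qRevFactor]
    have hz : q ^ (1 - ((k + 1 + l : ℕ) : ℤ)) * q ^ k * q ^ l = 1 := by
      rw [← zpow_natCast q k, ← zpow_natCast q l, ← zpow_add₀ hq, ← zpow_add₀ hq]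
      push_cast
      rw [show (1 - ((k : ℤ) + 1 + l) + k + l) = 0 by ring, zpow_zero]
    generalize q ^ (1 - ((k + 1 + l : ℕ) : ℤ)) = z at *
    have hfac : (1 - z / a * q ^ k) * a = -(z * q ^ k) * (1 - a * q ^ l) := by
      field_simp
      linear_combination (-a) * hz
    rw [pow_succ]
    linear_combination (-(z * q ^ k)) * ih + qPoch q (z / a) k * a ^ k * qPoch q a l * hfac

/-- The coefficient of `x^k` in the basic hypergeometric series `₂φ₁(b, c; -bc; q, x)`. -/
noncomputable def phiCoeff (q b c : ℂ) (k : ℕ) : ℂ :=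
  qPoch q b k * qPoch q c k / (qPoch q q k * qPoch q (-(b * c)) k)

/-- The coefficient of `x^n` in `₂φ₁(b, c; -bc; q, -x) * ₂φ₁(b, c; -bc; q, x)`. -/
noncomputable def phiConv (q b c : ℂ) (n : ℕ) : ℂ :=
  ∑ k ∈ Finset.range (n + 1), (-1) ^ k * (phiCoeff q b c k * phiCoeff q b c (n - k))

lemma phiConv_of_odd (q b c : ℂ) {n : ℕ} (hn : Odd n) : phiConv q b c n = 0 := by
  have h : phiConv q b c n = -phiConv q b c n := by
    conv_lhs => rw [phiConv, ← Finset.sum_range_reflect]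
    rw [phiConv, ← Finset.sum_neg_distrib]
    refine Finset.sum_congr rfl fun k hk => ?_
    have hk : k ≤ n := Nat.lt_succ_iff.1 (Finset.mem_range.1 hk)
    rw [show n + 1 - 1 - k = n - k by omega, show n - (n - k) = k by omega]
    have hs : (-1 : ℂ) ^ (n - k) = -(-1) ^ k := by
      have h1 : (-1 : ℂ) ^ (n - k) * (-1) ^ k = -1 := by
        rw [← pow_add, Nat.sub_add_cancel hk, hn.neg_one_pow]
      have h2 : (-1 : ℂ) ^ k * (-1) ^ k = 1 := by rw [← mul_pow]; simp
      linear_combination (-1) ^ k * h1 - (-1) ^ (n - k) * h2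
    rw [hs]
    ring
  linear_combination h / 2

lemma phiCoeff_zero (q b c : ℂ) : phiCoeff q b c 0 = 1 := by simp [phiCoeff, qPoch_zero]

lemma phiCoeff_succ {q b c : ℂ} {k : ℕ} (h1 : qPoch q q (k + 1) ≠ 0)
    (h2 : qPoch q (-(b * c)) (k + 1) ≠ 0) :
    phiCoeff q b c (k + 1) * ((1 - q * q ^ k) * (1 + b * c * q ^ k))
      = phiCoeff q b c k * ((1 - b * q ^ k) * (1 - c * q ^ k)) := by
  simp only [phiCoeff, qPoch_succ] at *
  rw [show 1 - -(b * c) * q ^ k = 1 + b * c * q ^ k by ring] at *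
  obtain ⟨h3, h4⟩ := mul_ne_zero_iff.1 h1
  obtain ⟨h5, h6⟩ := mul_ne_zero_iff.1 h2
  rw [div_mul_eq_mul_div, div_mul_eq_mul_div, div_eq_div_iff (by simp [*]) (by simp [*])]
  ring

/-- The telescoping certificate for the recurrence satisfied by `phiConv`. -/
noncomputable def phiCert (q b c M t : ℂ) : ℂ :=
  (1 - b ^ 2 * c ^ 2 * M) * (1 + b * c * M) * (1 - q * b * M) * (1 - q * c * M)
    - b * c * M * ((q - b * c - (b + c)) + b * c * M * (q - b * c + q * (b + c)))
      * (1 + q * M - t)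

lemma phiCert_identity (q b c x y : ℂ) :
    (1 - q ^ 2 * (x * y)) * (1 - b ^ 2 * c ^ 2 * (x * y)) * (1 + b * c * (x * y)) *
        (1 + q * (b * c) * (x * y)) * ((1 - b * x) * (1 - c * x) * ((1 - b * y) * (1 - c * y)))
      + (1 - b ^ 2 * (x * y)) * (1 - c ^ 2 * (x * y)) * (1 - b * c * (x * y)) *
        (1 - q * (b * c) * (x * y)) *
        ((1 - q * x) * (1 + b * c * x) * ((1 - q * y) * (1 + b * c * y)))
      = (1 - q * x) * (1 + b * c * x) * ((1 - b * y) * (1 - c * y)) *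
          phiCert q b c (x * y) (x + q * y)
        + (1 - b * x) * (1 - c * x) * ((1 - q * y) * (1 + b * c * y)) *
          phiCert q b c (x * y) (q * x + y) := by
  simp only [phiCert]
  ring

lemma phiCoeff_mul_recurrence {q b c : ℂ} {j l : ℕ} (hqj : qPoch q q (j + 1) ≠ 0)
    (hdj : qPoch q (-(b * c)) (j + 1) ≠ 0) (hql : qPoch q q (l + 1) ≠ 0)
    (hdl : qPoch q (-(b * c)) (l + 1) ≠ 0) :
    (1 - q ^ 2 * q ^ (j + l)) * (1 - b ^ 2 * c ^ 2 * q ^ (j + l)) * (1 + b * c * q ^ (j + l)) *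
        (1 + q * (b * c) * q ^ (j + l)) * (phiCoeff q b c (j + 1) * phiCoeff q b c (l + 1))
      + (1 - b ^ 2 * q ^ (j + l)) * (1 - c ^ 2 * q ^ (j + l)) * (1 - b * c * q ^ (j + l)) *
        (1 - q * (b * c) * q ^ (j + l)) * (phiCoeff q b c j * phiCoeff q b c l)
      = phiCoeff q b c j * phiCoeff q b c (l + 1)
          * phiCert q b c (q ^ (j + l)) (q ^ j + q ^ (l + 1))
        + phiCoeff q b c (j + 1) * phiCoeff q b c l
          * phiCert q b c (q ^ (j + l)) (q ^ (j + 1) + q ^ l) := by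
  have hj := phiCoeff_succ hqj hdj
  have hl := phiCoeff_succ hql hdl
  have key := phiCert_identity q b c (q ^ j) (q ^ l)
  have nonzero : ∀ k, qPoch q q (k + 1) ≠ 0 → qPoch q (-(b * c)) (k + 1) ≠ 0 →
      (1 - q * q ^ k) * (1 + b * c * q ^ k) ≠ 0 := by
    intro k h1 h2
    rw [qPoch_succ] at h1 h2
    rw [show 1 + b * c * q ^ k = 1 - -(b * c) * q ^ k by ring]
    exact mul_ne_zero (mul_ne_zero_iff.1 h1).2 (mul_ne_zero_iff.1 h2).2
  have hSj := nonzero j hqj hdj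
  have hSl := nonzero l hql hdl
  rw [← pow_add] at key
  rw [pow_succ' q j, pow_succ' q l]
  generalize (1 - q ^ 2 * q ^ (j + l)) * (1 - b ^ 2 * c ^ 2 * q ^ (j + l)) *
    (1 + b * c * q ^ (j + l)) * (1 + q * (b * c) * q ^ (j + l)) = A at *
  generalize (1 - b ^ 2 * q ^ (j + l)) * (1 - c ^ 2 * q ^ (j + l)) * (1 - b * c * q ^ (j + l)) *
    (1 - q * (b * c) * q ^ (j + l)) = B at *
  generalize phiCert q b c (q ^ (j + l)) (q ^ j + q * q ^ l) = R at *
  generalize phiCert q b c (q ^ (j + l)) (q * q ^ j + q ^ l) = R' at *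
  generalize (1 - q * q ^ j) * (1 + b * c * q ^ j) = S at *
  generalize (1 - q * q ^ l) * (1 + b * c * q ^ l) = S' at *
  generalize (1 - b * q ^ j) * (1 - c * q ^ j) = P at *
  generalize (1 - b * q ^ l) * (1 - c * q ^ l) = P' at *
  rw [← eq_div_iff hSj] at hj
  rw [← eq_div_iff hSl] at hl
  rw [hj, hl]
  field_simp
  linear_combination phiCoeff q b c j * phiCoeff q b c l * key

lemma sum_neg_one_pow_mul_add_succ (H : ℕ → ℂ) (N : ℕ) :
    ∑ j ∈ Finset.range N, (-1) ^ j * (H j + H (j + 1)) = H 0 - (-1) ^ N * H N := by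
  induction N with
  | zero => simp
  | succ N ih => rw [Finset.sum_range_succ, ih]; ring

lemma phiConv_add_two {q b c : ℂ} {n : ℕ} (hn : Even n) (h1 : qPoch q q (n + 2) ≠ 0)
    (h2 : qPoch q (-(b * c)) (n + 2) ≠ 0) :
    (1 - q ^ 2 * q ^ n) * (1 - b ^ 2 * c ^ 2 * q ^ n) * (1 + b * c * q ^ n) *
        (1 + q * (b * c) * q ^ n) * phiConv q b c (n + 2)
      = (1 - b ^ 2 * q ^ n) * (1 - c ^ 2 * q ^ n) * (1 - b * c * q ^ n) *
        (1 - q * (b * c) * q ^ n) * phiConv q b c n := by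
  have hend : (1 - q ^ 2 * q ^ n) * (1 - b ^ 2 * c ^ 2 * q ^ n) * (1 + b * c * q ^ n) *
      (1 + q * (b * c) * q ^ n) * phiCoeff q b c (n + 2)
      = phiCoeff q b c (n + 1) * phiCert q b c (q ^ n) (1 + q ^ (n + 1)) := by
    have h := phiCoeff_succ (k := n + 1) h1 h2
    rw [phiCert]
    rw [pow_succ' q n] at *
    linear_combination (1 - b ^ 2 * c ^ 2 * q ^ n) * (1 + b * c * q ^ n) * h
  let H : ℕ → ℂ := fun j => phiCoeff q b c j * phiCoeff q b c (n + 1 - j)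
    * phiCert q b c (q ^ n) (q ^ j + q ^ (n + 1 - j))
  have hmid := sum_neg_one_pow_mul_add_succ H (n + 1)
  have hstep : ∀ j ∈ Finset.range (n + 1), (-1) ^ j * (H j + H (j + 1))
      = (1 - q ^ 2 * q ^ n) * (1 - b ^ 2 * c ^ 2 * q ^ n) * (1 + b * c * q ^ n) *
          (1 + q * (b * c) * q ^ n)
          * ((-1) ^ j * (phiCoeff q b c (j + 1) * phiCoeff q b c (n + 2 - (j + 1))))
        + (1 - b ^ 2 * q ^ n) * (1 - c ^ 2 * q ^ n) * (1 - b * c * q ^ n) *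
          (1 - q * (b * c) * q ^ n)
          * ((-1) ^ j * (phiCoeff q b c j * phiCoeff q b c (n - j))) := by
    intro j hj
    obtain ⟨l, rfl⟩ := Nat.exists_eq_add_of_le (Nat.lt_succ_iff.1 (Finset.mem_range.1 hj))
    have h := phiCoeff_mul_recurrence (j := j) (l := l)
      (qPoch_ne_zero_of_le (by omega) h1) (qPoch_ne_zero_of_le (by omega) h2)
      (qPoch_ne_zero_of_le (by omega) h1) (qPoch_ne_zero_of_le (by omega) h2)
    simp only [H]
    rw [show j + l + 1 - j = l + 1 by omega, show j + l + 1 - (j + 1) = l by omega,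
      show j + l + 2 - (j + 1) = l + 1 by omega, show j + l - j = l by omega, ← h]
    ring
  rw [Finset.sum_congr rfl hstep, Finset.sum_add_distrib, ← Finset.mul_sum, ← Finset.mul_sum,
    ← phiConv, hn.add_one.neg_one_pow] at hmid
  have hsplit : phiConv q b c (n + 2) = 2 * phiCoeff q b c (n + 2)
      - ∑ j ∈ Finset.range (n + 1),
        (-1) ^ j * (phiCoeff q b c (j + 1) * phiCoeff q b c (n + 2 - (j + 1))) := by
    rw [phiConv, Finset.sum_range_succ, Finset.sum_range_succ', pow_add, hn.neg_one_pow,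
      sub_eq_add_neg, ← Finset.sum_neg_distrib,
      Finset.sum_congr rfl fun j _ => show (-1 : ℂ) ^ (j + 1) *
        (phiCoeff q b c (j + 1) * phiCoeff q b c (n + 2 - (j + 1))) =
        -((-1) ^ j * (phiCoeff q b c (j + 1) * phiCoeff q b c (n + 2 - (j + 1)))) by ring]
    simp only [Nat.sub_self, Nat.sub_zero, phiCoeff_zero]
    ring
  have hH0 : H 0 = phiCoeff q b c (n + 1) * phiCert q b c (q ^ n) (1 + q ^ (n + 1)) := by
    simp [H, phiCoeff_zero]
  have hHn : H (n + 1) = phiCoeff q b c (n + 1) * phiCert q b c (q ^ n) (1 + q ^ (n + 1)) := by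
    simp [H, phiCoeff_zero, add_comm]
  rw [hH0, hHn] at hmid
  rw [hsplit]
  linear_combination 2 * hend - hmid

lemma phiConv_two_mul {q b c : ℂ} {m : ℕ} (h1 : qPoch q q (2 * m) ≠ 0)
    (h2 : qPoch q (-(b * c)) (2 * m) ≠ 0) :
    phiConv q b c (2 * m) * (qPoch (q ^ 2) (q ^ 2) m * qPoch (q ^ 2) (b ^ 2 * c ^ 2) m *
        qPoch q (-(b * c)) (2 * m))
      = qPoch (q ^ 2) (b ^ 2) m * qPoch (q ^ 2) (c ^ 2) m * qPoch q (b * c) (2 * m) := by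
  induction m with
  | zero => simp [phiConv, phiCoeff_zero, qPoch_zero]
  | succ m ih =>
    have ih := ih (qPoch_ne_zero_of_le (by omega) h1) (qPoch_ne_zero_of_le (by omega) h2)
    have h := phiConv_add_two (even_two_mul m) h1 h2
    rw [show 2 * (m + 1) = 2 * m + 1 + 1 by ring]
    simp only [qPoch_succ, ← pow_mul, pow_succ q (2 * m)]
    linear_combination (qPoch (q ^ 2) (q ^ 2) m * qPoch (q ^ 2) (b ^ 2 * c ^ 2) m *
        qPoch q (-(b * c)) (2 * m)) * h + (1 - b ^ 2 * q ^ (2 * m)) * (1 - c ^ 2 * q ^ (2 * m)) *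
        (1 - b * c * q ^ (2 * m)) * (1 - q * (b * c) * q ^ (2 * m)) * ih

/-- The summand of the `₄φ₃` series as a summand of `phiConv`. -/
lemma bailey_summand_eq {q b c : ℂ} (hq : q ≠ 0) (hb : b ≠ 0) (hc : c ≠ 0) {n k : ℕ} (hkn : k ≤ n)
    (hqn : qPoch q q n ≠ 0) (hdn : qPoch q (-(b * c)) n ≠ 0) (hbn : qPoch q b n ≠ 0)
    (hcn : qPoch q c n ≠ 0) :
    qPoch q (q ^ (-(n : ℤ))) k * qPoch q b k * qPoch q c k *
        qPoch q (-(q ^ (1 - (n : ℤ)) / (b * c))) k * q ^ k /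
      (qPoch q q k * qPoch q (q ^ (1 - (n : ℤ)) / b) k * qPoch q (q ^ (1 - (n : ℤ)) / c) k *
        qPoch q (-(b * c)) k)
      = qPoch q q n * qPoch q (-(b * c)) n / (qPoch q b n * qPoch q c n) *
        ((-1) ^ k * (phiCoeff q b c k * phiCoeff q b c (n - k))) := by
  have hd : -(b * c) ≠ 0 := neg_ne_zero.2 (mul_ne_zero hb hc)
  have rq := qPoch_reverse hq hq hkn
  have rb := qPoch_reverse hq hb hkn
  have rc := qPoch_reverse hq hc hkn
  have rd := qPoch_reverse hq hd hkn
  rw [show q ^ (1 - (n : ℤ)) / q = q ^ (-(n : ℤ)) by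
    rw [div_eq_iff hq, ← zpow_add_one₀ hq]; congr 1; ring] at rq
  rw [div_neg] at rd
  have hg := qRevFactor_ne_zero hq n k
  have hqk := qPoch_ne_zero_of_le hkn hqn
  have hdk := qPoch_ne_zero_of_le hkn hdn
  have hql := qPoch_ne_zero_of_le (Nat.sub_le n k) hqn
  have hbl := qPoch_ne_zero_of_le (Nat.sub_le n k) hbn
  have hcl := qPoch_ne_zero_of_le (Nat.sub_le n k) hcn
  have hdl := qPoch_ne_zero_of_le (Nat.sub_le n k) hdn
  have hqp := pow_ne_zero k hq
  have hbp := pow_ne_zero k hb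
  have hcp := pow_ne_zero k hc
  have hs : (-1 : ℂ) ^ k * (-1) ^ k = 1 := by rw [← mul_pow]; simp
  have hdp : (-(b * c)) ^ k = (-1) ^ k * (b ^ k * c ^ k) := by rw [neg_pow, mul_pow]
  have hsp : (-1 : ℂ) ^ k ≠ 0 := by simp
  rw [hdp] at rd
  rw [mul_assoc, ← eq_div_iff (by simp [*])] at rq rb rc rd
  rw [rq, rb, rc, rd, phiCoeff, phiCoeff]
  generalize (-1 : ℂ) ^ k = s at *
  field_simp
  linear_combination (-(qPoch q b k * qPoch q c k)) * hs

/-- Bailey's ₄φ₃ summation formula. -/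
theorem bailey_4phi3_summation (n : ℕ) (q b c : ℂ) (hq : q ≠ 0) (hb : b ≠ 0) (hc : c ≠ 0)
    (hden : ∀ k ≤ n,
      qPoch q q k * qPoch q (q ^ (1 - (n : ℤ)) / b) k * qPoch q (q ^ (1 - (n : ℤ)) / c) k *
        qPoch q (-(b * c)) k ≠ 0)
    (hden2 : n % 2 = 0 →
      qPoch q b n * qPoch q c n * qPoch (q ^ 2) (b ^ 2 * c ^ 2) (n / 2) ≠ 0) :
    ∑ k ∈ Finset.range (n + 1),
      qPoch q (q ^ (-(n : ℤ))) k * qPoch q b k * qPoch q c k *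
        qPoch q (-(q ^ (1 - (n : ℤ)) / (b * c))) k * q ^ k /
      (qPoch q q k * qPoch q (q ^ (1 - (n : ℤ)) / b) k * qPoch q (q ^ (1 - (n : ℤ)) / c) k *
        qPoch q (-(b * c)) k)
    = if n % 2 = 0 then
        qPoch (q ^ 2) q (n / 2) * qPoch (q ^ 2) (b ^ 2) (n / 2) * qPoch (q ^ 2) (c ^ 2) (n / 2) *
          qPoch q (b * c) n /
        (qPoch q b n * qPoch q c n * qPoch (q ^ 2) (b ^ 2 * c ^ 2) (n / 2))
      else 0 := by
  have hall := hden n le_rfl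
  have hbr := qPoch_reverse hq hb (le_refl n)
  have hcr := qPoch_reverse hq hc (le_refl n)
  simp only [Nat.sub_self, qPoch_zero, mul_one] at hbr hcr
  simp only [mul_ne_zero_iff] at hall
  obtain ⟨⟨⟨hqn, hbn⟩, hcn⟩, hdn⟩ := hall
  have hbn : qPoch q b n ≠ 0 :=
    right_ne_zero_of_mul (hbr ▸ mul_ne_zero hbn (pow_ne_zero n hb))
  have hcn : qPoch q c n ≠ 0 :=
    right_ne_zero_of_mul (hcr ▸ mul_ne_zero hcn (pow_ne_zero n hc))
  rw [Finset.sum_congr rfl fun k hk => bailey_summand_eq hq hb hc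
    (Nat.lt_succ_iff.1 (Finset.mem_range.1 hk)) hqn hdn hbn hcn, ← Finset.mul_sum, ← phiConv]
  split_ifs with hn
  · obtain ⟨m, rfl⟩ : ∃ m, n = 2 * m := ⟨n / 2, by omega⟩
    have hden2 := right_ne_zero_of_mul (hden2 hn)
    rw [Nat.mul_div_cancel_left m two_pos] at *
    have h := phiConv_two_mul hqn hdn
    rw [qPoch_self_two_mul] at *
    have hq2 := right_ne_zero_of_mul hqn
    field_simp
    linear_combination qPoch (q ^ 2) q m * h
  · rw [phiConv_of_odd q b c (Nat.odd_iff.2 (by omega)), mul_zero]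
end

section
/- Contiguous relation for well-poised terms (second form): Let $r \ge 1$ and $k \ge 1$ be integers, and let $q, z, a_1, \ldots, a_{r+1}$ be nonzero complex numbers such that all factors occurring in denominators below are nonzero. Define $F_k(a_1, a_2, \ldots, a_{r+1}; q, z) = \frac{(a_1;q)_k (a_2;q)_k \cdots (a_{r+1};q)_k}{(q;q)_k (a_1q/a_2;q)_k \cdots (a_1q/a_{r+1};q)_k} z^k$. Then $F_k(a_1, a_2, \ldots, a_r, a_{r+1}; q, qz) - F_k(a_1, a_2, \ldots, a_r, a_{r+1}q; q, z) = \beta \, F_{k-1}(a_1q^2, a_2q, \ldots, a_{r+1}q; q, z)$, where $\beta = -\frac{(1-a_1)(1-a_1q)(1-a_2)\cdots(1-a_r)\, z}{(1 - a_1/a_{r+1})(1 - a_1q/a_2)\cdots(1 - a_1q/a_{r+1})}$. -/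
set_option autoImplicit false

/-- The `k`-th term of a well-poised basic hypergeometric series with parameters
`a 1, a 2, …, a (r+1)`:
`F_k(a_1,…,a_{r+1};q,z) = (a_1,…,a_{r+1};q)_k / ((q;q)_k (a_1 q/a_2,…,a_1 q/a_{r+1};q)_k) z^k`. -/
noncomputable def wpTerm (r : ℕ) (a : ℕ → ℂ) (q z : ℂ) (k : ℕ) : ℂ :=
  (∏ i ∈ Finset.Icc 1 (r + 1), qPoch q (a i) k) /
    (qPoch q q k * ∏ i ∈ Finset.Icc 2 (r + 1), qPoch q (a 1 * q / a i) k) * z ^ k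

theorem qPoch_succ_right (q x : ℂ) (n : ℕ) :
    qPoch q x (n + 1) = qPoch q x n * (1 - x * q ^ n) :=
  Finset.prod_range_succ _ _

theorem qPoch_succ_left (q x : ℂ) (n : ℕ) :
    qPoch q x (n + 1) = (1 - x) * qPoch q (x * q) n := by
  simp only [qPoch, Finset.prod_range_succ', pow_zero, mul_one]
  rw [mul_comm]
  congr 1
  exact Finset.prod_congr rfl fun j _ => by ring

theorem prod_qPoch_succ_left {ι : Type*} (s : Finset ι) (q : ℂ) (f : ι → ℂ) (n : ℕ) :
    ∏ i ∈ s, qPoch q (f i) (n + 1) = (∏ i ∈ s, (1 - f i)) * ∏ i ∈ s, qPoch q (f i * q) n := by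
  simp only [qPoch_succ_left, Finset.prod_mul_distrib]

theorem prod_Icc_two_succ (s : ℕ) (f : ℕ → ℂ) :
    ∏ i ∈ Finset.Icc 2 (s + 1 + 1), f i = (∏ i ∈ Finset.Icc 2 (s + 1), f i) * f (s + 2) :=
  Finset.prod_Icc_succ_top (by omega) f

/-- A well-poised term with its first and last parameters split off. -/
theorem wpTerm_split (s : ℕ) (a : ℕ → ℂ) (q z : ℂ) (k : ℕ) :
    wpTerm (s + 1) a q z k =
      qPoch q (a 1) k * ((∏ i ∈ Finset.Icc 2 (s + 1), qPoch q (a i) k) * qPoch q (a (s + 2)) k) /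
        (qPoch q q k * ((∏ i ∈ Finset.Icc 2 (s + 1), qPoch q (a 1 * q / a i) k) *
          qPoch q (a 1 * q / a (s + 2)) k)) * z ^ k := by
  have h : Finset.Icc 1 (s + 1 + 1) = insert 1 (Finset.Icc 2 (s + 1 + 1)) := by
    ext i
    simp only [Finset.mem_Icc, Finset.mem_insert]
    omega
  rw [wpTerm, h, Finset.prod_insert (by simp), prod_Icc_two_succ, prod_Icc_two_succ]

/-- Contiguous relation for well-poised terms (second form), Eq. (1.2). -/
theorem contiguous_relation_second (r k : ℕ) (hr : 1 ≤ r) (hk : 1 ≤ k) (q z : ℂ) (a : ℕ → ℂ)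
    (hq : q ≠ 0) (hz : z ≠ 0) (ha : ∀ i ∈ Finset.Icc 1 (r + 1), a i ≠ 0)
    (a'' b : ℕ → ℂ)
    (ha'' : a'' = Function.update a (r + 1) (a (r + 1) * q))
    (hb : b = fun i => if i = 1 then a 1 * q ^ 2 else a i * q)
    (hd1 : qPoch q q k * ∏ i ∈ Finset.Icc 2 (r + 1), qPoch q (a 1 * q / a i) k ≠ 0)
    (hd2 : qPoch q q k * ∏ i ∈ Finset.Icc 2 (r + 1), qPoch q (a'' 1 * q / a'' i) k ≠ 0)
    (hd3 : qPoch q q (k - 1) *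
      ∏ i ∈ Finset.Icc 2 (r + 1), qPoch q (b 1 * q / b i) (k - 1) ≠ 0)
    (hd4 : (1 - a 1 / a (r + 1)) * ∏ i ∈ Finset.Icc 2 (r + 1), (1 - a 1 * q / a i) ≠ 0) :
    wpTerm r a q (q * z) k - wpTerm r a'' q z k
    = -((1 - a 1) * (1 - a 1 * q) * (∏ i ∈ Finset.Icc 2 r, (1 - a i)) * z /
        ((1 - a 1 / a (r + 1)) * ∏ i ∈ Finset.Icc 2 (r + 1), (1 - a 1 * q / a i))) *
        wpTerm r b q z (k - 1) := by
  obtain ⟨s, rfl⟩ : ∃ s, r = s + 1 := ⟨r - 1, by omega⟩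
  obtain ⟨n, rfl⟩ : ∃ n, k = n + 1 := ⟨k - 1, by omega⟩
  have hc : a (s + 2) ≠ 0 := ha _ (by simp)
  have ha1 : a'' 1 = a 1 := by simp [ha'']
  have hatop : a'' (s + 2) = a (s + 2) * q := by simp [ha'']
  have hamid : ∀ i ∈ Finset.Icc 2 (s + 1), a'' i = a i := fun i hi => by
    rw [ha'', Function.update_of_ne]
    have := (Finset.mem_Icc.1 hi).2
    omega
  have hb1 : b 1 = a 1 * q * q := by simp [hb, pow_two, mul_assoc]
  have hb2 : ∀ i, 2 ≤ i → b i = a i * q := fun i hi => by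
    simp [hb, show i ≠ 1 by omega]
  have hbq : ∀ i, 2 ≤ i → b 1 * q / b i = a 1 * q / a i * q := fun i hi => by
    rw [hb1, hb2 i hi, mul_div_mul_right _ _ hq]
    ring
  have hPa : ∏ i ∈ Finset.Icc 2 (s + 1), qPoch q (a'' i) (n + 1) =
      ∏ i ∈ Finset.Icc 2 (s + 1), qPoch q (a i) (n + 1) :=
    Finset.prod_congr rfl fun i hi => by rw [hamid i hi]
  have hQa : ∏ i ∈ Finset.Icc 2 (s + 1), qPoch q (a'' 1 * q / a'' i) (n + 1) =
      ∏ i ∈ Finset.Icc 2 (s + 1), qPoch q (a 1 * q / a i) (n + 1) :=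
    Finset.prod_congr rfl fun i hi => by rw [ha1, hamid i hi]
  have hPb : ∏ i ∈ Finset.Icc 2 (s + 1), qPoch q (b i) n =
      ∏ i ∈ Finset.Icc 2 (s + 1), qPoch q (a i * q) n :=
    Finset.prod_congr rfl fun i hi => by rw [hb2 i (Finset.mem_Icc.1 hi).1]
  have hQb : ∏ i ∈ Finset.Icc 2 (s + 1), qPoch q (b 1 * q / b i) n =
      ∏ i ∈ Finset.Icc 2 (s + 1), qPoch q (a 1 * q / a i * q) n :=
    Finset.prod_congr rfl fun i hi => by rw [hbq i (Finset.mem_Icc.1 hi).1]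
  have hctop : a'' 1 * q / a'' (s + 2) = a 1 / a (s + 2) := by
    rw [ha1, hatop, mul_div_mul_right _ _ hq]
  have hcq : a 1 / a (s + 2) * q = a 1 * q / a (s + 2) := by ring
  rw [prod_Icc_two_succ] at hd1 hd4
  rw [prod_Icc_two_succ (f := fun i => 1 - a 1 * q / a i), wpTerm_split, wpTerm_split,
    Nat.add_sub_cancel, wpTerm_split, hPa, hQa, hPb, hQb, hctop, ha1, hatop,
    hbq (s + 2) (by omega), hb2 (s + 2) (by omega), hb1]
  have hA : (1 - a 1) * (1 - a 1 * q) * qPoch q (a 1 * q * q) n =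
      qPoch q (a 1) (n + 1) * (1 - a 1 * q ^ (n + 1)) := by
    rw [← qPoch_succ_right, qPoch_succ_left, qPoch_succ_left, mul_assoc]
  have hlast : (1 - a 1 * q / a (s + 2)) * qPoch q (a 1 * q / a (s + 2) * q) n =
      qPoch q (a 1 * q / a (s + 2)) n * (1 - a 1 * q / a (s + 2) * q ^ n) := by
    rw [← qPoch_succ_left, qPoch_succ_right]
  rw [prod_qPoch_succ_left, qPoch_succ_right q q, qPoch_succ_right q (a 1 * q / a (s + 2))] at hd1
  rw [prod_qPoch_succ_left, prod_qPoch_succ_left, qPoch_succ_right q q,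
    qPoch_succ_right q (a 1 * q / a (s + 2)), qPoch_succ_left q (a (s + 2)),
    qPoch_succ_right q (a (s + 2) * q), qPoch_succ_left q (a 1 / a (s + 2)), hcq]
  generalize qPoch q (a 1) (n + 1) = A1 at *
  generalize qPoch q (a 1 * q * q) n = A2 at *
  generalize qPoch q (a 1 * q / a (s + 2)) n = C1 at *
  generalize qPoch q (a 1 * q / a (s + 2) * q) n = C2 at *
  generalize qPoch q (a (s + 2) * q) n = C3 at *
  generalize qPoch q q n = Q at *
  generalize (∏ i ∈ Finset.Icc 2 (s + 1), (1 - a i)) = P1 at *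
  generalize (∏ i ∈ Finset.Icc 2 (s + 1), qPoch q (a i * q) n) = P2 at *
  generalize (∏ i ∈ Finset.Icc 2 (s + 1), (1 - a 1 * q / a i)) = R1 at *
  generalize (∏ i ∈ Finset.Icc 2 (s + 1), qPoch q (a 1 * q / a i * q) n) = R2 at *
  simp only [mul_ne_zero_iff] at hd1 hd4
  obtain ⟨⟨hQ, hqn⟩, ⟨hR1, hR2⟩, hC1, hCn⟩ := hd1
  obtain ⟨hAc, -, hAqc⟩ := hd4
  have hrhs : -((1 - a 1) * (1 - a 1 * q) * P1 * z /
        ((1 - a 1 / a (s + 2)) * (R1 * (1 - a 1 * q / a (s + 2))))) *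
        (A2 * (P2 * C3) / (Q * (R2 * C2)) * z ^ n) =
      -(((1 - a 1) * (1 - a 1 * q) * A2) * P1 * P2 * C3 * z ^ (n + 1) /
        ((1 - a 1 / a (s + 2)) * R1 * R2 * Q * ((1 - a 1 * q / a (s + 2)) * C2))) := by
    rw [neg_mul, ← mul_assoc, div_mul_div_comm, div_mul_eq_mul_div]
    congr 2 <;> ring
  refine Eq.trans ?_ hrhs.symm
  rw [hA, hlast, mul_pow]
  have hqn' : 1 - q ^ (n + 1) ≠ 0 := by rwa [pow_succ']
  have hCn' : 1 - a 1 / a (s + 2) * q ^ (n + 1) ≠ 0 := by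
    convert hCn using 1
    ring
  rw [show 1 - q * q ^ n = 1 - q ^ (n + 1) by ring,
    show 1 - a 1 * q / a (s + 2) * q ^ n = 1 - a 1 / a (s + 2) * q ^ (n + 1) by ring,
    show 1 - a (s + 2) * q * q ^ n = 1 - a (s + 2) * q ^ (n + 1) by ring]
  have hA' : a 1 = a 1 / a (s + 2) * a (s + 2) := (div_mul_cancel₀ _ hc).symm
  rw [show 1 - a 1 * q ^ (n + 1) = 1 - a 1 / a (s + 2) * a (s + 2) * q ^ (n + 1) by rw [← hA']]
  generalize a 1 / a (s + 2) = d at *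
  generalize q ^ (n + 1) = x at *
  generalize z ^ (n + 1) = y at *
  have hdx : 1 - x * d ≠ 0 := by rwa [mul_comm]
  field_simp
  ring
end
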